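/- Let A be the all-one input for the team power game with n ≥ 1 teams and m ≥ 1 time slots, i.e., A i j = 1 for all i, j. Then the strategy profile B = A is a t-strong Nash equilibrium for A for every positive integer t; in particular, A admits a t-strong Nash equilibrium for every t. -/

import Mathlib

open Finset

section TPG

variable {T C : Type*} [Fintype T] [Fintype C] [DecidableEq T] [DecidableEq C]

/-- Sum of declared availabilities at a time slot. -/
def colSum (B : T → C → ℕ) (j : C) : ℕ := ∑ i, B i j

/-- Winning time slots: those maximizing the column sum. -/
def winners (B : T → C → ℕ) : Finset C :=
  Finset.univ.filter fun j => ∀ j', colSum B j' ≤ colSum B j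

/-- Relative power of team `i` at slot `j` (0 when the denominator is 0). -/
def power (B : T → C → ℕ) (i : T) (j : C) : ℚ :=
  (B i j : ℚ) / (colSum B j : ℚ)

/-- Pay-off of team `i`: minimum relative power over all winning slots. -/
def payoff (B : T → C → ℕ) (i : T) : ℚ :=
  if h : (winners B).Nonempty then (winners B).inf' h (power B i) else 0

/-- `B` is a strategy profile for input `A`. -/
def IsProfile (A B : T → C → ℕ) : Prop := ∀ i j, B i j ≤ A i j

/-- `D` is an improvement step for coalition `S` with respect to `B` (for input `A`). -/
def IsImprovement (A B : T → C → ℕ) (S : Finset T) (D : T → C → ℕ) : Prop :=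
  IsProfile A D ∧ (∀ i ∉ S, ∀ j, D i j = B i j) ∧ ∀ i ∈ S, payoff B i < payoff D i

/-- `B` is a `t`-strong Nash equilibrium for `A`. -/
def IsStrongNash (t : ℕ) (A B : T → C → ℕ) : Prop :=
  IsProfile A B ∧
    ∀ S : Finset T, S.Nonempty → S.card ≤ t → ∀ D, ¬ IsImprovement A B S D

end TPG

section AllOne

variable {T C : Type*} [Fintype T] [Fintype C]

lemma winners_nonempty [Nonempty C] (B : T → C → ℕ) : (winners B).Nonempty := by
  obtain ⟨j, -, hj⟩ := Finset.exists_max_image Finset.univ (colSum B) Finset.univ_nonempty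
  exact ⟨j, by simpa [winners] using hj⟩

lemma payoff_le_power {B : T → C → ℕ} {j : C} (hj : j ∈ winners B) (i : T) :
    payoff B i ≤ power B i j := by
  rw [payoff, dif_pos ⟨j, hj⟩]
  exact Finset.inf'_le _ hj

lemma payoff_all_one [Nonempty C] (i : T) :
    payoff (fun (_ : T) (_ : C) => 1) i = 1 / (Fintype.card T : ℚ) := by
  have hpower : power (fun (_ : T) (_ : C) => 1) i = fun _ => 1 / (Fintype.card T : ℚ) := by
    ext j
    simp [power, colSum]
  rw [payoff, dif_pos (winners_nonempty _), hpower, Finset.inf'_const]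

/-- Truth-telling is a strong equilibrium for the all-one input: a team with positive pay-off
declares one at every winning slot, so after an improvement step a winning column would be
all-one again and nobody would have gained. -/
theorem isStrongNash_all_one [Nonempty C] (t : ℕ) :
    IsStrongNash t (fun (_ : T) (_ : C) => 1) (fun _ _ => 1) := by
  refine ⟨fun _ _ => le_rfl, ?_⟩
  rintro S ⟨i, hi⟩ - D ⟨hD, hout, hgain⟩
  obtain ⟨j, hj⟩ := winners_nonempty D
  have hpower : ∀ k ∈ S, 1 / (Fintype.card T : ℚ) < power D k j := fun k hk =>
    payoff_all_one (C := C) k ▸ (hgain k hk).trans_le (payoff_le_power hj k)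
  have hone : ∀ k, D k j = 1 := by
    intro k
    by_cases hk : k ∈ S
    · have hne : D k j ≠ 0 := by
        intro h0
        have h := hpower k hk
        rw [power, h0, Nat.cast_zero, zero_div] at h
        exact h.not_ge (by positivity)
      exact le_antisymm (hD k j) (Nat.one_le_iff_ne_zero.mpr hne)
    · exact hout k hk j
  have h := hpower i hi
  simp [power, colSum, hone] at h

end AllOne

/-- For the all-one input, declaring the truth is a `t`-strong Nash equilibrium for
every positive integer `t`; in particular a `t`-strong Nash equilibrium exists for
every `t`. -/
theorem all_one_input_truth_is_strong_nash (n m : ℕ) (hn : 1 ≤ n) (hm : 1 ≤ m)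
    (t : ℕ) (ht : 1 ≤ t) :
    IsStrongNash t (fun _ _ => 1 : Fin n → Fin m → ℕ) (fun _ _ => 1) ∧
    ∃ B : Fin n → Fin m → ℕ,
      IsStrongNash t (fun _ _ => 1 : Fin n → Fin m → ℕ) B := by
  have : Nonempty (Fin m) := ⟨⟨0, hm⟩⟩
  exact ⟨isStrongNash_all_one t, _, isStrongNash_all_one t⟩
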